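/- arXiv:1901.09361 — 3 statements merged into one kernel-verified Lean document; each statement's English description precedes it below -/
import Mathlib

section
/- Let x and y be pyramidal tours with step-backs in the complete digraph on {1,…,n} with x ≠ y. If the vertices x^v and y^v of the polytope PSB(n) are nonadjacent in the 1-skeleton of PSB(n), then there exist at least two pyramidal tours with step-backs z₁ and z₂ with z₁ ≠ z₂, each different from both x and y, such that every arc of z₁ and every arc of z₂ is an arc of x or an arc of y (i.e., the multigraph x ∪ y includes at least two pyramidal tours with step-backs other than x and y). -/
/-!
Formalization of pyramidal tours with step-backs (Nikolaev, arXiv:1901.09361).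

Cities are `Fin n` (city `c` of the paper, `1 ≤ c ≤ n`, is the element of
`Fin n` with value `c - 1`; so "city 1" is `0` and "city n" is `topCity n`).
A Hamiltonian tour in the complete digraph is a permutation of the cities that
is a single cycle through all of them; the arc leaving city `i` in the tour
`τ` is `(i, τ i)`.
-/

open Equiv

namespace PSBPaper

variable {n : ℕ}

/-- The largest city (city `n` of the paper). -/
def topCity (n : ℕ) [NeZero n] : Fin n := ⟨n - 1, Nat.sub_lt (NeZero.pos n) one_pos⟩

/-- A Hamiltonian tour: a permutation forming a single directed cycle visiting
every city exactly once. -/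
def IsHamTour (τ : Equiv.Perm (Fin n)) : Prop :=
  τ.IsCycle ∧ ∀ i, τ i ≠ i

/-- City `i` is a peak of `τ`: both its predecessor and successor are smaller. -/
def IsPeak (τ : Equiv.Perm (Fin n)) (i : Fin n) : Prop :=
  τ⁻¹ i < i ∧ τ i < i

/-- City `i` is a step-back peak of `τ`. -/
def IsStepBackPeak (τ : Equiv.Perm (Fin n)) (i : Fin n) : Prop :=
  (τ⁻¹ i < i ∧ (τ i).val + 1 = i.val ∧ i < τ (τ i)) ∨
  (i < τ⁻¹ (τ⁻¹ i) ∧ (τ⁻¹ i).val + 1 = i.val ∧ τ i < i)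

/-- A proper peak: a peak that is not a step-back peak. -/
def IsProperPeak (τ : Equiv.Perm (Fin n)) (i : Fin n) : Prop :=
  IsPeak τ i ∧ ¬ IsStepBackPeak τ i

/-- A pyramidal tour with step-backs: a Hamiltonian tour whose only proper peak
is the city `n`. -/
def IsPSBT [NeZero n] (τ : Equiv.Perm (Fin n)) : Prop :=
  IsHamTour τ ∧ ∀ i, IsProperPeak τ i ↔ i = topCity n

/-- Characteristic vector of a tour: entry `1` on arcs of the tour, `0` elsewhere. -/
def charVec (τ : Equiv.Perm (Fin n)) : Fin n × Fin n → ℝ :=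
  fun e => if τ e.1 = e.2 then 1 else 0

/-- The vertices of `PSB(n)` distinct from `x^v` and `y^v`. -/
def otherVerts [NeZero n] (x y : Equiv.Perm (Fin n)) : Set (Fin n × Fin n → ℝ) :=
  {v | ∃ z : Equiv.Perm (Fin n), IsPSBT z ∧ z ≠ x ∧ z ≠ y ∧ v = charVec z}

/-- Nonadjacency of the vertices `x^v` and `y^v` in the 1-skeleton of `PSB(n)`:
some point of the open segment joining them lies in the convex hull of the
remaining vertices of the polytope. -/
def Nonadjacent [NeZero n] (x y : Equiv.Perm (Fin n)) : Prop :=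
  ∃ p ∈ openSegment ℝ (charVec x) (charVec y), p ∈ convexHull ℝ (otherVerts x y)

/-- City `i` is visited by `τ` in ascending order: it is reached from city `1`
no later than the first visit to city `n` (direction bit `x^{0,1}_i = 1`). -/
def AscCity [NeZero n] (τ : Equiv.Perm (Fin n)) (i : Fin n) : Prop :=
  ∃ k : ℕ, (τ ^ k) 0 = i ∧ ∀ m < k, (τ ^ m) 0 ≠ topCity n

/-- The arc of `τ` leaving city `i` belongs to the ascending path (from city 1
to city n) of `τ`. -/
def AscArc [NeZero n] (τ : Equiv.Perm (Fin n)) (i : Fin n) : Prop :=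
  AscCity τ i ∧ i ≠ topCity n

/-- Ascending step-back of `τ` at `(i, i+1)`: `τ` enters `i+1` from a city
smaller than `i`, goes `i+1 → i`, then `i →` a city larger than `i+1`. -/
def AscSB (τ : Equiv.Perm (Fin n)) (i j : Fin n) : Prop :=
  j.val = i.val + 1 ∧ τ⁻¹ j < i ∧ τ j = i ∧ j < τ i

/-- Descending step-back of `τ` at `(i, i+1)`: `τ` enters `i` from a city
larger than `i+1`, goes `i → i+1`, then `i+1 →` a city smaller than `i`. -/
def DescSB (τ : Equiv.Perm (Fin n)) (i j : Fin n) : Prop :=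
  j.val = i.val + 1 ∧ j < τ⁻¹ i ∧ τ i = j ∧ τ j < i

/-- City `i` is involved in some step-back of `τ`. -/
def InSB (τ : Equiv.Perm (Fin n)) (i : Fin n) : Prop :=
  ∃ j, AscSB τ i j ∨ AscSB τ j i ∨ DescSB τ i j ∨ DescSB τ j i

/-- `i` is the lower city of an ascending step-back of `τ`. -/
def AscSBLower (τ : Equiv.Perm (Fin n)) (i : Fin n) : Prop := ∃ j, AscSB τ i j

/-- `j` is the upper city of an ascending step-back of `τ`. -/
def AscSBUpper (τ : Equiv.Perm (Fin n)) (j : Fin n) : Prop := ∃ i, AscSB τ i j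

/-- `i` is the lower city of a descending step-back of `τ`. -/
def DescSBLower (τ : Equiv.Perm (Fin n)) (i : Fin n) : Prop := ∃ j, DescSB τ i j

/-- `j` is the upper city of a descending step-back of `τ`. -/
def DescSBUpper (τ : Equiv.Perm (Fin n)) (j : Fin n) : Prop := ∃ i, DescSB τ i j

/-- Single `U`-block of the pair `(x, y)` at city `i`: both tours visit `i` in
the same order and neither has a step-back involving `i` (`U₁₁` and `U₀₀`). -/
def SingleU [NeZero n] (x y : Equiv.Perm (Fin n)) (i : Fin n) : Prop :=
  ((AscCity x i ∧ AscCity y i) ∨ (¬AscCity x i ∧ ¬AscCity y i)) ∧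
    ¬InSB x i ∧ ¬InSB y i

/-- Double `U`-block at `(i, i+1)`: both tours have an ascending step-back at
`(i,i+1)` (`U₁₁₁₁`), or both have a descending one (`U₀₀₀₀`). -/
def DoubleU (x y : Equiv.Perm (Fin n)) (i j : Fin n) : Prop :=
  (AscSB x i j ∧ AscSB y i j) ∨ (DescSB x i j ∧ DescSB y i j)

/-- `L`-blocks `L₁₁₁₀`, `L₁₀₁₁`, `L₀₀₀₁`, `L₀₁₀₀` at `(i, i+1)`. -/
def LBlock [NeZero n] (x y : Equiv.Perm (Fin n)) (i j : Fin n) : Prop :=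
  (AscSB x i j ∧ AscCity y i ∧ ¬InSB y i ∧ ¬AscCity y j) ∨
  (AscSB y i j ∧ AscCity x i ∧ ¬InSB x i ∧ ¬AscCity x j) ∨
  (DescSB x i j ∧ ¬AscCity y i ∧ ¬InSB y i ∧ AscCity y j) ∨
  (DescSB y i j ∧ ¬AscCity x i ∧ ¬InSB x i ∧ AscCity x j)

/-- `R`-blocks `R₁₁₀₁`, `R₀₁₁₁`, `R₀₀₁₀`, `R₁₀₀₀` at `(i, i+1)`. -/
def RBlock [NeZero n] (x y : Equiv.Perm (Fin n)) (i j : Fin n) : Prop :=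
  (AscSB x i j ∧ ¬AscCity y i ∧ AscCity y j ∧ ¬InSB y j) ∨
  (AscSB y i j ∧ ¬AscCity x i ∧ AscCity x j ∧ ¬InSB x j) ∨
  (DescSB x i j ∧ AscCity y i ∧ ¬AscCity y j ∧ ¬InSB y j) ∨
  (DescSB y i j ∧ AscCity x i ∧ ¬AscCity x j ∧ ¬InSB x j)

/-- The encodings `x^{0,1,sb}` and `y^{0,1,sb}` agree at the city `k`:
same direction bit and the same step-back markers. -/
def EncAgree [NeZero n] (x y : Equiv.Perm (Fin n)) (k : Fin n) : Prop :=
  (AscCity x k ↔ AscCity y k) ∧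
  (AscSBLower x k ↔ AscSBLower y k) ∧ (AscSBUpper x k ↔ AscSBUpper y k) ∧
  (DescSBLower x k ↔ DescSBLower y k) ∧ (DescSBUpper x k ↔ DescSBUpper y k)

/-- The ascending step-back data of `x` and `y` agree at `k`. -/
def AscDataAgree (x y : Equiv.Perm (Fin n)) (k : Fin n) : Prop :=
  (AscSBLower x k ↔ AscSBLower y k) ∧ (AscSBUpper x k ↔ AscSBUpper y k)

/-- The descending step-back data of `x` and `y` agree at `k`. -/
def DescDataAgree (x y : Equiv.Perm (Fin n)) (k : Fin n) : Prop :=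
  (DescSBLower x k ↔ DescSBLower y k) ∧ (DescSBUpper x k ↔ DescSBUpper y k)

/-- `x` and `y` differ in the left part: the encodings differ at some
coordinate (city number) in `[2, i_a − 1]`.  City numbers are `k.val + 1`. -/
def DiffLeft [NeZero n] (x y : Equiv.Perm (Fin n)) (ia : ℕ) : Prop :=
  ∃ k : Fin n, 2 ≤ k.val + 1 ∧ k.val + 1 ≤ ia - 1 ∧ ¬EncAgree x y k

/-- `x` and `y` differ in the right part: the encodings differ at some
coordinate (city number) in `[j_b + 1, n − 1]`. -/
def DiffRight [NeZero n] (x y : Equiv.Perm (Fin n)) (jb : ℕ) : Prop :=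
  ∃ k : Fin n, jb + 1 ≤ k.val + 1 ∧ k.val + 1 ≤ n - 1 ∧ ¬EncAgree x y k

/-- `x` and `y` differ in the central part in ascending order. -/
def DiffCentralAsc [NeZero n] (x y : Equiv.Perm (Fin n)) (ia jb : ℕ) : Prop :=
  ∃ k : Fin n, ia ≤ k.val + 1 ∧ k.val + 1 ≤ jb ∧
    AscCity x k ∧ AscCity y k ∧ ¬AscDataAgree x y k

/-- `x` and `y` differ in the central part in descending order. -/
def DiffCentralDesc [NeZero n] (x y : Equiv.Perm (Fin n)) (ia jb : ℕ) : Prop :=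
  ∃ k : Fin n, ia ≤ k.val + 1 ∧ k.val + 1 ≤ jb ∧
    ¬AscCity x k ∧ ¬AscCity y k ∧ ¬DescDataAgree x y k

/-- `b` is an admissible direction bit of `τ` at city `i`: at the cities `1`
and `n` either bit is allowed, elsewhere it is the actual direction bit. -/
def DirBitOK [NeZero n] (τ : Equiv.Perm (Fin n)) (i : Fin n) (b : Bool) : Prop :=
  i.val = 0 ∨ i.val = n - 1 ∨ (b = true ↔ AscCity τ i)

/-- Left block with first city after the block having city number `ia` and
admissible direction bit `bi` of `x` at the block city: either the city `1`
(`ia = 2`), a single `U`-block at `i` (`ia = i + 1` in city numbers, i.e.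
`i.val + 2`), or a double `U`- or `L`-block at `(i, i+1)` (`ia = i + 2`). -/
def LeftBlockSpec [NeZero n] (x y : Equiv.Perm (Fin n)) (ia : ℕ) (bi : Bool) : Prop :=
  ia = 2 ∨
  (∃ i : Fin n, SingleU x y i ∧ ia = i.val + 2 ∧ DirBitOK x i bi) ∨
  (∃ i j : Fin n, (DoubleU x y i j ∨ LBlock x y i j) ∧ ia = i.val + 3 ∧ DirBitOK x i bi)

/-- Right block with last city before the block having city number `jb`:
either the city `n` (`jb = n − 1`), a single `U`-block at `j` (`jb = j − 1`
in city numbers, i.e. `j.val`), or a double `U`- or `R`-block at `(j−1, j)`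
(`jb = j − 2`, i.e. `j.val − 1`). -/
def RightBlockSpec [NeZero n] (x y : Equiv.Perm (Fin n)) (jb : ℕ) (bj : Bool) : Prop :=
  jb = n - 1 ∨
  (∃ j : Fin n, SingleU x y j ∧ jb = j.val ∧ DirBitOK x j bj) ∨
  (∃ i j : Fin n, (DoubleU x y i j ∨ RBlock x y i j) ∧ jb = j.val - 1 ∧ DirBitOK x j bj)

/-- The direction bits of `x` and `y` coincide on the central part
(city numbers from `ia` to `jb`). -/
def CentralDirEq [NeZero n] (x y : Equiv.Perm (Fin n)) (ia jb : ℕ) : Prop :=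
  ∀ k : Fin n, ia ≤ k.val + 1 → k.val + 1 ≤ jb → (AscCity x k ↔ AscCity y k)

/-- The four case conditions of the adjacency criterion, depending on the
(admissible) direction bits of `x` at the left and right block cities. -/
def CaseCond [NeZero n] (x y : Equiv.Perm (Fin n)) (ia jb : ℕ) : Bool → Bool → Prop
  | true, true =>
      DiffCentralAsc x y ia jb ∧
        (DiffLeft x y ia ∨ DiffCentralDesc x y ia jb ∨ DiffRight x y jb)
  | false, false =>
      DiffCentralDesc x y ia jb ∧
        (DiffLeft x y ia ∨ DiffCentralAsc x y ia jb ∨ DiffRight x y jb)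
  | true, false =>
      (DiffCentralAsc x y ia jb ∨ DiffRight x y jb) ∧
        (DiffCentralDesc x y ia jb ∨ DiffLeft x y ia)
  | false, true =>
      (DiffCentralDesc x y ia jb ∨ DiffRight x y jb) ∧
        (DiffCentralAsc x y ia jb ∨ DiffLeft x y ia)

/-- The block conditions for the pair `(x, y)`. -/
def BlockConditions [NeZero n] (x y : Equiv.Perm (Fin n)) : Prop :=
  ∃ (ia jb : ℕ) (bi bj : Bool),
    LeftBlockSpec x y ia bi ∧ RightBlockSpec x y jb bj ∧
    CentralDirEq x y ia jb ∧ CaseCond x y ia jb bi bj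

/-- `z` switches from `x` to `y` at city `i`: the arc of `z` entering `i` is an
arc of `x`, the arc of `z` leaving `i` is an arc of `y`, and at least one of
these two arcs belongs to exactly one of the tours `x`, `y`. -/
def SwitchXtoY (x y z : Equiv.Perm (Fin n)) (i : Fin n) : Prop :=
  x (z⁻¹ i) = i ∧ y i = z i ∧ (y (z⁻¹ i) ≠ i ∨ x i ≠ z i)

/-- `z` switches from `y` to `x` at city `i`. -/
def SwitchYtoX (x y z : Equiv.Perm (Fin n)) (i : Fin n) : Prop :=
  y (z⁻¹ i) = i ∧ x i = z i ∧ (x (z⁻¹ i) ≠ i ∨ y i ≠ z i)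

/-- `z^v` appears with a positive coefficient in some convex combination of the
vertices `{w^v : w ∈ PSBT_n, w ≠ x, w ≠ y}` that equals a point of the open
segment joining `x^v` and `y^v`. -/
def PositiveWitness [NeZero n] (x y z : Equiv.Perm (Fin n)) : Prop :=
  ∃ β : Equiv.Perm (Fin n) → ℝ,
    (∀ w, 0 ≤ β w) ∧
    (∀ w, β w ≠ 0 → IsPSBT w ∧ w ≠ x ∧ w ≠ y) ∧
    (∑ w : Equiv.Perm (Fin n), β w) = 1 ∧
    (∑ w : Equiv.Perm (Fin n), β w • charVec w) ∈
      openSegment ℝ (charVec x) (charVec y) ∧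
    0 < β z

end PSBPaper

namespace PSBPaper

variable {n : ℕ}

lemma charVec_apply_self (τ : Equiv.Perm (Fin n)) (i : Fin n) : charVec τ (i, τ i) = 1 := by
  simp [charVec]

lemma charVec_nonneg (τ : Equiv.Perm (Fin n)) (e : Fin n × Fin n) : 0 ≤ charVec τ e := by
  unfold charVec
  split_ifs <;> norm_num

/-- A tour of positive weight in a convex combination representing a point of the segment
between `x^v` and `y^v` only uses arcs of `x` and `y`. -/
lemma arc_mem_union_of_pos_weight {ι : Type*} [Fintype ι] {x y : Equiv.Perm (Fin n)}
    {τ : ι → Equiv.Perm (Fin n)} {w : ι → ℝ} {a b : ℝ} (hw : ∀ l, 0 ≤ w l)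
    (hsum : ∑ l, w l • charVec (τ l) = a • charVec x + b • charVec y)
    {l : ι} (hl : 0 < w l) (i : Fin n) : τ l i = x i ∨ τ l i = y i := by
  by_contra! h
  have hzero : ∑ m, w m * charVec (τ m) (i, τ l i) = 0 := by
    simpa [charVec, Finset.sum_apply, h.1.symm, h.2.symm] using congrFun hsum (i, τ l i)
  have hterm := (Finset.sum_eq_zero_iff_of_nonneg
    fun m _ => mul_nonneg (hw m) (charVec_nonneg _ _)).1 hzero l (Finset.mem_univ l)
  rw [charVec_apply_self, mul_one] at hterm
  exact hl.ne' hterm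

/-- If a convex combination of characteristic vectors has an entry strictly between `0` and `1`,
then some tour of positive weight contains the corresponding arc and some other does not. -/
lemma exists_pos_weight_mem_and_notMem {ι : Type*} [Fintype ι]
    {τ : ι → Equiv.Perm (Fin n)} {w : ι → ℝ} (hw : ∀ l, 0 ≤ w l) (hw1 : ∑ l, w l = 1)
    {e : Fin n × Fin n} (h0 : 0 < ∑ l, w l * charVec (τ l) e)
    (h1 : ∑ l, w l * charVec (τ l) e < 1) :
    (∃ l, 0 < w l ∧ τ l e.1 = e.2) ∧ ∃ l, 0 < w l ∧ τ l e.1 ≠ e.2 := by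
  constructor
  · by_contra! h
    refine h0.ne' (Finset.sum_eq_zero fun l _ => ?_)
    rcases (hw l).eq_or_lt with hl | hl
    · simp [← hl]
    · simp [charVec, h l hl]
  · by_contra! h
    refine h1.ne (hw1 ▸ Finset.sum_congr rfl fun l _ => ?_)
    rcases (hw l).eq_or_lt with hl | hl
    · simp [← hl]
    · simp [charVec, h l hl]

end PSBPaper

open PSBPaper Equiv in
/-- Lemma 2, necessary condition for nonadjacency.
If the vertices `x^v` and `y^v` of `PSB(n)` are nonadjacent, then the
multigraph `x ∪ y` includes at least two pyramidal tours with step-backs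
other than `x` and `y`: there are `z₁ ≠ z₂`, each different from both `x`
and `y`, all of whose arcs are arcs of `x` or of `y`. -/
theorem exists_two_tours_in_union_of_nonadjacent (n : ℕ)
    (x y : Equiv.Perm (Fin (n + 4)))
    (hx : IsPSBT x) (hy : IsPSBT y) (hxy : x ≠ y)
    (hnadj : Nonadjacent x y) :
    ∃ z₁ z₂ : Equiv.Perm (Fin (n + 4)),
      IsPSBT z₁ ∧ IsPSBT z₂ ∧ z₁ ≠ z₂ ∧
      z₁ ≠ x ∧ z₁ ≠ y ∧ z₂ ≠ x ∧ z₂ ≠ y ∧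
      (∀ i, z₁ i = x i ∨ z₁ i = y i) ∧
      (∀ i, z₂ i = x i ∨ z₂ i = y i) := by
  obtain ⟨p, ⟨a, b, ha, hb, hab, hp⟩, hconv⟩ := hnadj
  obtain ⟨ι, _, w, z, hw, hw1, hz, hwz⟩ := mem_convexHull_iff_exists_fintype.1 hconv
  choose τ hτ hτx hτy hzτ using hz
  obtain rfl : z = fun l => charVec (τ l) := funext hzτ
  have hsum : ∑ l, w l • charVec (τ l) = a • charVec x + b • charVec y := hwz.trans hp.symm
  obtain ⟨k, hk⟩ : ∃ k, x k ≠ y k := by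
    by_contra! h
    exact hxy (Equiv.ext h)
  have hentry : ∑ l, w l * charVec (τ l) (k, x k) = a := by
    simpa [charVec, Finset.sum_apply, hk.symm] using congrFun hsum (k, x k)
  obtain ⟨⟨l, hl, hlk⟩, m, hm, hmk⟩ := exists_pos_weight_mem_and_notMem hw hw1
    (hentry.symm ▸ ha) (hentry.symm ▸ by linarith)
  refine ⟨τ l, τ m, hτ l, hτ m, ?_, hτx l, hτy l, hτx m, hτy m,
    arc_mem_union_of_pos_weight hw hsum hl, arc_mem_union_of_pos_weight hw hsum hm⟩
  intro h
  exact hmk (h ▸ hlk)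
end

section
/- Let x and y be pyramidal tours with step-backs in the complete digraph on {1,…,n} with x ≠ y, let e_x be an arc of x and e_y an arc of y such that no pyramidal tour with step-backs contains both e_x and e_y. Suppose the vertices x^v and y^v of PSB(n) are nonadjacent, and suppose α x^v + (1−α) y^v = Σ_w β_w w^v for some 0 < α < 1, where the sum is a convex combination (β_w ≥ 0, Σ β_w = 1) over tours w ∈ PSBT_n with w ≠ x and w ≠ y. Then β_w = 0 for every tour w that contains neither e_x nor e_y; equivalently, every tour w with β_w > 0 contains e_x or e_y. -/
/-!
Formalization of pyramidal tours with step-backs (Nikolaev, arXiv:1901.09361).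

Cities are `Fin n` (city `c` of the paper, `1 ≤ c ≤ n`, is the element of
`Fin n` with value `c - 1`; so "city 1" is `0` and "city n" is `topCity n`).
A Hamiltonian tour in the complete digraph is a permutation of the cities that
is a single cycle through all of them; the arc leaving city `i` in the tour
`τ` is `(i, τ i)`.
-/

open Equiv

open PSBPaper Equiv in
/-- Lemma 3.
Let `e_x` be an arc of `x` and `e_y` an arc of `y` such that no pyramidal tour
with step-backs contains both. If `x^v` and `y^v` are nonadjacent and
`α x^v + (1−α) y^v = Σ_w β_w w^v` is a convex combination over tours
`w ∈ PSBT_n` with `w ≠ x`, `w ≠ y`, then `β_w = 0` for every tour `w`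
containing neither `e_x` nor `e_y`. -/
theorem coeff_zero_of_missing_both_arcs (n : ℕ)
    (x y : Equiv.Perm (Fin (n + 4)))
    (hx : IsPSBT x) (hy : IsPSBT y) (hxy : x ≠ y)
    (ex ey : Fin (n + 4) × Fin (n + 4))
    (hex : x ex.1 = ex.2) (hey : y ey.1 = ey.2)
    (hforb : ∀ w : Equiv.Perm (Fin (n + 4)), IsPSBT w →
      ¬ (w ex.1 = ex.2 ∧ w ey.1 = ey.2))
    (hnadj : Nonadjacent x y)
    (α : ℝ) (hα0 : 0 < α) (hα1 : α < 1)
    (β : Equiv.Perm (Fin (n + 4)) → ℝ)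
    (hβnn : ∀ w, 0 ≤ β w)
    (hβsupp : ∀ w, β w ≠ 0 → IsPSBT w ∧ w ≠ x ∧ w ≠ y)
    (hβsum : (∑ w : Equiv.Perm (Fin (n + 4)), β w) = 1)
    (hcomb : α • charVec x + (1 - α) • charVec y
      = ∑ w : Equiv.Perm (Fin (n + 4)), β w • charVec w) :
    ∀ w : Equiv.Perm (Fin (n + 4)),
      w ex.1 ≠ ex.2 → w ey.1 ≠ ey.2 → β w = 0 := by
  have hyx : y ex.1 ≠ ex.2 := fun h => hforb y hy ⟨h, hey⟩
  have hxy' : x ey.1 ≠ ey.2 := fun h => hforb x hx ⟨hex, h⟩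
  have hsum_ex : α = ∑ w, β w * charVec w ex := by
    simpa [charVec, hex, hyx] using congrFun hcomb ex
  have hsum_ey : 1 - α = ∑ w, β w * charVec w ey := by
    simpa [charVec, hey, hxy'] using congrFun hcomb ey
  have hsum : ∑ w, β w * (1 - charVec w ex - charVec w ey) = 0 := by
    simp only [mul_sub, mul_one, Finset.sum_sub_distrib]
    linarith
  have hnonneg : ∀ w ∈ Finset.univ, 0 ≤ β w * (1 - charVec w ex - charVec w ey) := by
    intro w _
    by_cases hβ : β w = 0
    · simp [hβ]
    · have hw := hforb w (hβsupp w hβ).1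
      refine mul_nonneg (hβnn w) ?_
      by_cases h₁ : w ex.1 = ex.2 <;> by_cases h₂ : w ey.1 = ey.2 <;> simp_all [charVec]
  intro w h₁ h₂
  simpa [charVec, h₁, h₂] using
    (Finset.sum_eq_zero_iff_of_nonneg hnonneg).1 hsum w (Finset.mem_univ w)
end

section
/- Let x, y be pyramidal tours with step-backs in the complete digraph on {1,…,n} with x ≠ y whose vertices x^v and y^v of PSB(n) are nonadjacent, and let z be a pyramidal tour with step-backs different from x and y, every arc of which is an arc of x or of y, such that z^v appears with a positive coefficient in some convex combination of the vertices {w^v : w ∈ PSBT_n, w ≠ x, w ≠ y} that equals a point of the open segment joining x^v and y^v. Then every arc of the ascending path of z (from city 1 to city n) is an arc of the ascending path of x or an arc of the ascending path of y, and every arc of the descending path of z (from n back to 1) is an arc of the descending path of x or an arc of the descending path of y. -/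
/-!
Formalization of pyramidal tours with step-backs (Nikolaev, arXiv:1901.09361).

Cities are `Fin n` (city `c` of the paper, `1 ≤ c ≤ n`, is the element of
`Fin n` with value `c - 1`; so "city 1" is `0` and "city n" is `topCity n`).
A Hamiltonian tour in the complete digraph is a permutation of the cities that
is a single cycle through all of them; the arc leaving city `i` in the tour
`τ` is `(i, τ i)`.
-/

open Equiv

namespace PSBPaper

section Tours

variable [NeZero n] {τ : Equiv.Perm (Fin n)}

theorem ne_topCity_of_lt {i j : Fin n} (h : i < j) : i ≠ topCity n := by
  rintro rfl
  have := j.isLt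
  simp only [topCity, Fin.lt_def] at h
  omega

theorem ascArc_iff {i : Fin n} :
    AscArc τ i ↔ ∃ k : ℕ, (τ ^ k) 0 = i ∧ ∀ m ≤ k, (τ ^ m) 0 ≠ topCity n := by
  constructor
  · rintro ⟨⟨k, rfl, hk⟩, hi⟩
    exact ⟨k, rfl, fun m hm => (Nat.lt_or_eq_of_le hm).elim (hk m) (by rintro rfl; exact hi)⟩
  · rintro ⟨k, rfl, hk⟩
    exact ⟨⟨k, rfl, fun m hm => hk m hm.le⟩, hk k le_rfl⟩

theorem AscArc.apply {i : Fin n} (h : AscArc τ i) (hi : τ i ≠ topCity n) : AscArc τ (τ i) := by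
  obtain ⟨k, rfl, hk⟩ := ascArc_iff.1 h
  refine ascArc_iff.2 ⟨k + 1, by rw [pow_succ', Perm.mul_apply], fun m hm => ?_⟩
  rcases Nat.lt_or_eq_of_le hm with hm | rfl
  · exact hk m (by omega)
  · rwa [pow_succ', Perm.mul_apply]

theorem AscArc.of_apply {i : Fin n} (h : AscArc τ (τ i)) (hi : τ i ≠ 0) : AscArc τ i := by
  obtain ⟨k, hki, hk⟩ := ascArc_iff.1 h
  cases k with
  | zero => exact absurd hki.symm hi
  | succ k =>
    rw [pow_succ', Perm.mul_apply] at hki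
    exact ascArc_iff.2 ⟨k, τ.injective hki, fun m hm => hk m (by omega)⟩

theorem IsPSBT.inv (h : IsPSBT τ) : IsPSBT τ⁻¹ := by
  refine ⟨⟨h.1.1.inv, fun i hi => h.1.2 i ?_⟩, fun i => ?_⟩
  · exact (Perm.inv_eq_iff_eq.1 hi).symm
  · rw [← h.2 i]
    simp only [IsProperPeak, IsPeak, IsStepBackPeak, inv_inv]
    tauto

/-- The ascending path goes up except at ascending step-backs. -/
theorem IsPSBT.lt_or_ascSB_pow (h : IsPSBT τ) (k : ℕ)
    (hk : ∀ m ≤ k, (τ ^ m) 0 ≠ topCity n) :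
    (τ ^ k) 0 < (τ ^ (k + 1)) 0 ∨ AscSB τ ((τ ^ (k + 1)) 0) ((τ ^ k) 0) := by
  induction k using Nat.strong_induction_on with
  | _ k ih =>
  cases k with
  | zero =>
    left
    have h0 := h.1.2 0
    simp only [pow_zero, Perm.one_apply, zero_add, pow_one, Fin.lt_def]
    rw [Ne, Fin.ext_iff] at h0
    simp only [Fin.val_zero] at h0 ⊢
    omega
  | succ k =>
    have ih1 := ih k (by omega) (fun m hm => hk m (by omega))
    have hs : ∀ m, (τ ^ (m + 1)) 0 = τ ((τ ^ m) 0) := fun m => by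
      rw [pow_succ', Perm.mul_apply]
    have hp : ∀ m, τ⁻¹ ((τ ^ (m + 1)) 0) = (τ ^ m) 0 := fun m => by simp [hs]
    rcases lt_or_ge ((τ ^ (k + 1)) 0) ((τ ^ (k + 1 + 1)) 0) with hlt | hge
    · exact Or.inl hlt
    have hne := h.1.2 ((τ ^ (k + 1)) 0)
    have hgt : τ ((τ ^ (k + 1)) 0) < (τ ^ (k + 1)) 0 := by
      rw [hs (k + 1)] at hge
      exact lt_of_le_of_ne hge hne
    rcases ih1 with hup | hsb
    · have hpk : IsStepBackPeak τ ((τ ^ (k + 1)) 0) := by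
        by_contra hn
        exact hk (k + 1) le_rfl ((h.2 _).1 ⟨⟨by rwa [hp], hgt⟩, hn⟩)
      rcases hpk with ⟨h1, h2, h3⟩ | ⟨h1, h2, h3⟩
      · right
        refine ⟨by rw [hs (k + 1)]; exact h2.symm, ?_, (hs _).symm, by rw [hs (k + 1)]; exact h3⟩
        rw [hp] at h1 ⊢
        rw [hs (k + 1)]
        have : τ ((τ ^ (k + 1)) 0) ≠ (τ ^ k) 0 := by
          intro e
          rw [e, ← hs] at h3
          exact lt_irrefl _ h3
        rw [Ne, Fin.ext_iff] at this
        rw [Fin.lt_def] at h1 ⊢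
        omega
      · exfalso
        rw [hp] at h1 h2
        cases k with
        | zero =>
          have h4 : τ ((τ ^ 1) 0) = 0 := by
            simp only [pow_zero, Perm.one_apply, Fin.lt_def, Fin.val_zero, zero_add] at h2 h3
            apply Fin.ext
            simp only [Fin.val_zero]
            omega
          have h5 : τ⁻¹ 0 = (τ ^ 1) 0 := Perm.inv_eq_iff_eq.2 h4.symm
          simp only [pow_zero, Perm.one_apply, zero_add] at h1
          rw [h5] at h1
          exact lt_irrefl _ h1
        | succ k =>
          rw [hp] at h1
          rcases ih k (by omega) (fun m hm => hk m (by omega)) with h4 | ⟨-, -, -, h4⟩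
          · exact absurd (h1.trans h4) (not_lt.2 hup.le)
          · rw [← hs] at h4
            exact lt_asymm h1 h4
    · exfalso
      obtain ⟨h1, -, -, h4⟩ := hsb
      have := h4.trans hgt
      rw [Fin.lt_def] at this
      omega

theorem IsPSBT.pow_lt_pow_add_two (h : IsPSBT τ) (k : ℕ)
    (hk : ∀ m ≤ k + 1, (τ ^ m) 0 ≠ topCity n) : (τ ^ k) 0 < (τ ^ (k + 2)) 0 := by
  have hs : ∀ m, (τ ^ (m + 1)) 0 = τ ((τ ^ m) 0) := fun m => by
    rw [pow_succ', Perm.mul_apply]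
  have h1 := h.lt_or_ascSB_pow k (fun m hm => hk m (by omega))
  have h2 := h.lt_or_ascSB_pow (k + 1) hk
  rcases h1 with h1 | ⟨-, -, -, h1⟩
  · rcases h2 with h2 | ⟨-, h2, -, -⟩
    · exact h1.trans h2
    · have : τ⁻¹ ((τ ^ (k + 1)) 0) = (τ ^ k) 0 := by simp [hs]
      rwa [this] at h2
  · rwa [← hs] at h1

/-- Cities of the ascending path at least two steps apart are visited in increasing order. -/
theorem IsPSBT.pow_lt_pow (h : IsPSBT τ) (k m : ℕ)
    (hk : ∀ l ≤ k + m + 1, (τ ^ l) 0 ≠ topCity n) : (τ ^ k) 0 < (τ ^ (k + m + 2)) 0 := by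
  have hs : ∀ m, (τ ^ (m + 1)) 0 = τ ((τ ^ m) 0) := fun m => by
    rw [pow_succ', Perm.mul_apply]
  induction m using Nat.strong_induction_on with
  | _ m ih =>
  match m with
  | 0 => exact h.pow_lt_pow_add_two k hk
  | m + 2 =>
    exact (ih m (by omega) fun l hl => hk l (by omega)).trans
      (h.pow_lt_pow_add_two (k + m + 2) fun l hl => hk l (by omega))
  | 1 =>
    have h2 := h.pow_lt_pow_add_two k fun l hl => hk l (by omega)
    have h3 := h.pow_lt_pow_add_two (k + 1) fun l hl => hk l (by omega)
    rcases h.lt_or_ascSB_pow k (fun l hl => hk l (by omega)) with h1 | ⟨h1, h5, -, -⟩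
    · exact h1.trans h3
    rcases h.lt_or_ascSB_pow (k + 2) (fun l hl => hk l (by omega)) with h4 | ⟨h4, -, -, -⟩
    · exact h2.trans h4
    have hne : (τ ^ (k + 2 + 1)) 0 ≠ (τ ^ k) 0 := by
      intro e
      have h6 : τ⁻¹ ((τ ^ k) 0) = (τ ^ (k + 2)) 0 := Perm.inv_eq_iff_eq.2 (by rw [← e, hs])
      rw [h6] at h5
      rw [Fin.lt_def] at h5
      omega
    rw [Ne, Fin.ext_iff] at hne
    have h6 : k + 1 + 2 = k + 2 + 1 := by omega
    rw [h6] at h3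
    have h7 : k + 1 + 1 + 1 = k + 2 + 1 := by omega
    rw [Fin.lt_def] at h3 h2 ⊢
    change _ < ((τ ^ (k + 2 + 1)) 0).val
    omega

theorem IsPSBT.lt_or_ascSB (h : IsPSBT τ) {i : Fin n} (hi : AscArc τ i) :
    i < τ i ∨ AscSB τ (τ i) i := by
  obtain ⟨k, rfl, hk⟩ := ascArc_iff.1 hi
  have := h.lt_or_ascSB_pow k hk
  rwa [pow_succ', Perm.mul_apply] at this

/-- An ascending city strictly below an upward arc of the ascending path is next to that arc. -/
theorem IsPSBT.asc_gap (h : IsPSBT τ) {p r : Fin n} (hp : AscArc τ p) (hr : AscArc τ r)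
    (hpr : p < r) (hrq : r < τ p) : τ (τ p) = r ∨ τ r = p := by
  have hs : ∀ m, (τ ^ (m + 1)) 0 = τ ((τ ^ m) 0) := fun m => by
    rw [pow_succ', Perm.mul_apply]
  obtain ⟨k, rfl, hk⟩ := ascArc_iff.1 hp
  obtain ⟨m, rfl, hm⟩ := ascArc_iff.1 hr
  rw [← hs] at hrq
  rcases lt_trichotomy k m with hkm | rfl | hkm
  · obtain ⟨d, rfl⟩ := Nat.exists_eq_add_of_lt hkm
    match d with
    | 0 => exact absurd hrq (lt_irrefl _)
    | 1 => left; rw [← hs, ← hs]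
    | d + 2 =>
      have := h.pow_lt_pow (k + 1) d fun l hl => hm l (by omega)
      rw [show k + 1 + d + 2 = k + (d + 2) + 1 by omega] at this
      exact absurd hrq (lt_asymm this)
  · exact absurd hpr (lt_irrefl _)
  · obtain ⟨d, rfl⟩ := Nat.exists_eq_add_of_lt hkm
    match d with
    | 0 => exact Or.inr (hs m).symm
    | d + 1 =>
      exact absurd hpr (lt_asymm (h.pow_lt_pow m d fun l hl => hk l (by omega)))

theorem IsHamTour.zero_ne_topCity (h : IsHamTour τ) : (0 : Fin n) ≠ topCity n := by
  intro e
  have h0 := h.2 0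
  rw [Fin.ext_iff] at e
  simp only [topCity, Fin.val_zero] at e
  have := (τ 0).isLt
  rw [Ne, Fin.ext_iff] at h0
  simp only [Fin.val_zero] at h0
  omega

/-- Reversing a tour exchanges its ascending and descending paths. -/
theorem IsHamTour.ascArc_inv_apply_iff (h : IsHamTour τ) (i : Fin n) :
    AscArc τ⁻¹ (τ i) ↔ ¬ AscArc τ i := by
  have hreach : ∀ j, ∃ k : ℕ, (τ ^ k) 0 = j := fun j => h.1.exists_pow_eq (h.2 0) (h.2 j)
  constructor
  · intro h1 h2
    obtain ⟨m, hmi, hm⟩ := ascArc_iff.1 h1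
    obtain ⟨k, rfl, hk⟩ := ascArc_iff.1 h2
    obtain ⟨K, hK⟩ : ∃ K, (τ ^ K) 0 = topCity n ∧ ∀ l < K, (τ ^ l) 0 ≠ topCity n :=
      ⟨Nat.find (hreach (topCity n)), Nat.find_spec (hreach _), fun l hl => Nat.find_min _ hl⟩
    have hkK : k < K := by
      by_contra hc
      exact hk K (by omega) hK.1
    have hm0 : (τ ^ (m + (k + 1))) 0 = 0 := by
      rw [pow_add, Perm.mul_apply, pow_succ' τ k, Perm.mul_apply, ← hmi, inv_pow]
      simp
    by_cases hle : K ≤ m + (k + 1)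
    · obtain ⟨d, hd⟩ := Nat.exists_eq_add_of_le' hle
      refine hm d (by omega) ?_
      rw [hd, pow_add, Perm.mul_apply, hK.1] at hm0
      rw [inv_pow, Perm.inv_eq_iff_eq, hm0]
    · obtain ⟨d, hd⟩ := Nat.exists_eq_add_of_lt (not_le.1 hle)
      refine hK.2 (d + 1) (by omega) ?_
      rw [← hK.1, hd, show m + (k + 1) + d + 1 = (d + 1) + (m + (k + 1)) by omega,
        pow_add τ (d + 1), Perm.mul_apply, hm0]
  · intro h2
    obtain ⟨N, hN, hN0, hmin⟩ : ∃ N, 0 < N ∧ (τ ^ N) 0 = 0 ∧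
        ∀ l, 0 < l → l < N → (τ ^ l) 0 ≠ 0 := by
      have hex : ∃ N, 0 < N ∧ (τ ^ N) 0 = 0 :=
        ⟨orderOf τ, orderOf_pos τ, by rw [pow_orderOf_eq_one]; rfl⟩
      exact ⟨Nat.find hex, (Nat.find_spec hex).1, (Nat.find_spec hex).2,
        fun l hl hlN he => Nat.find_min hex hlN ⟨hl, he⟩⟩
    have hsub : ∀ a d, (τ ^ (a + d)) 0 = (τ ^ a) 0 → (τ ^ d) 0 = 0 := fun a d hd => by
      rw [pow_add, Perm.mul_apply] at hd
      exact (τ ^ a).injective hd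
    have hex : ∃ k, (τ ^ k) 0 = i := hreach i
    obtain ⟨k, rfl, hkmin⟩ : ∃ k, (τ ^ k) 0 = i ∧ ∀ l < k, (τ ^ l) 0 ≠ i :=
      ⟨Nat.find hex, Nat.find_spec hex, fun l hl => Nat.find_min _ hl⟩
    have hkN : k < N := by
      by_contra hc
      obtain ⟨d, rfl⟩ := Nat.exists_eq_add_of_le' (not_lt.1 hc)
      exact hkmin d (by omega) (by rw [pow_add, Perm.mul_apply, hN0])
    have : ∃ K ≤ k, (τ ^ K) 0 = topCity n := by
      by_contra hc
      push Not at hc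
      exact h2 (ascArc_iff.2 ⟨k, rfl, hc⟩)
    obtain ⟨K, hKk, hK⟩ := this
    have hinv : ∀ m ≤ N, (τ⁻¹ ^ m) 0 = (τ ^ (N - m)) 0 := fun m hm => by
      rw [inv_pow, Perm.inv_eq_iff_eq, ← Perm.mul_apply, ← pow_add,
        Nat.add_sub_cancel' hm, hN0]
    refine ascArc_iff.2 ⟨N - (k + 1), ?_, fun m hm => ?_⟩
    · rw [hinv _ (by omega), show N - (N - (k + 1)) = k + 1 by omega, pow_succ', Perm.mul_apply]
    · rw [hinv m (by omega), ← hK]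
      rcases Nat.eq_zero_or_pos m with rfl | hm0
      · rw [Nat.sub_zero, hN0, hK]
        exact h.zero_ne_topCity
      · intro e
        obtain ⟨d, hd⟩ := Nat.exists_eq_add_of_le (show K ≤ N - m by omega)
        rw [hd] at e
        exact hmin d (by omega) (by omega) (hsub _ _ e)

theorem IsPSBT.gt_or_descSB (h : IsPSBT τ) {i : Fin n} (hi : ¬ AscArc τ i) :
    τ i < i ∨ DescSB τ i (τ i) := by
  have := h.inv.lt_or_ascSB ((h.1.ascArc_inv_apply_iff i).2 hi)
  simpa [AscSB, DescSB, and_comm] using this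

theorem IsPSBT.desc_gap (h : IsPSBT τ) {p r : Fin n} (hp : ¬ AscArc τ p) (hr : ¬ AscArc τ r)
    (hpr : r < p) (hrq : τ p < r) : τ (τ p) = r ∨ τ r = p := by
  have h1 : AscArc τ⁻¹ r := by
    rw [← τ.apply_symm_apply r]
    refine (h.1.ascArc_inv_apply_iff _).2 fun hc => hr ?_
    have := hc.apply (by rw [τ.apply_symm_apply]; exact ne_topCity_of_lt hpr)
    rwa [τ.apply_symm_apply] at this
  have h2 := h.inv.asc_gap ((h.1.ascArc_inv_apply_iff p).2 hp) h1 hrq (by simpa using hpr)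
  have h3 : τ⁻¹ (τ p) = p := τ.symm_apply_apply p
  rw [h3, Perm.inv_eq_iff_eq, Perm.inv_eq_iff_eq] at h2
  rcases h2 with h2 | h2
  · exact Or.inr h2.symm
  · exact Or.inl h2.symm

end Tours

theorem AscSB.pred_lt {τ : Equiv.Perm (Fin n)} {i j c : Fin n} (h : AscSB τ i j) (hc : τ c = j) :
    c < i := by
  have h1 : τ⁻¹ j = c := Perm.inv_eq_iff_eq.2 hc.symm
  exact h1 ▸ h.2.1

theorem DescSB.lt_pred {τ : Equiv.Perm (Fin n)} {i j c : Fin n} (h : DescSB τ i j) (hc : τ c = i) :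
    j < c := by
  have h1 : τ⁻¹ i = c := Perm.inv_eq_iff_eq.2 hc.symm
  exact h1 ▸ h.2.1

/-- If `z` uses one arc of `x` not in `y` and avoids another one, then some tour contained in
the union of `x` and `y` does the opposite. -/
def Exchange [NeZero n] (x y z : Equiv.Perm (Fin n)) : Prop :=
  ∀ p q r s, x p = q → y p ≠ q → z p = q → x r = s → y r ≠ s → z r ≠ s →
    ∃ w : Equiv.Perm (Fin n), IsPSBT w ∧ (∀ i, w i = x i ∨ w i = y i) ∧ w p ≠ q ∧ w r = s

section Exchange

variable [NeZero n] {x y z : Equiv.Perm (Fin n)}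

theorem PositiveWitness.symm (h : PositiveWitness x y z) : PositiveWitness y x z := by
  obtain ⟨β, h0, h1, h2, h3, h4⟩ := h
  refine ⟨β, h0, fun w hw => ?_, h2, ?_, h4⟩
  · obtain ⟨h5, h6, h7⟩ := h1 w hw
    exact ⟨h5, h7, h6⟩
  · rwa [openSegment_symm]

theorem PositiveWitness.exchange (h : PositiveWitness x y z) : Exchange x y z := by
  obtain ⟨β, h0, h1, -, ⟨a, b, -, -, -, hab⟩, hz⟩ := h
  have heval : ∀ i j, (∑ w : Equiv.Perm (Fin n), β w * (if w i = j then 1 else 0)) =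
      a * (if x i = j then 1 else 0) + b * (if y i = j then 1 else 0) := fun i j => by
    have := congrFun hab (i, j)
    simpa [charVec, Finset.sum_apply] using this.symm
  intro p q r s hxp hyp hzp hxr hyr hzr
  by_contra hcon
  have hsupp : ∀ w, β w ≠ 0 → ∀ i, w i = x i ∨ w i = y i := fun w hw i => by
    by_contra hc
    push Not at hc
    have h2 := heval i (w i)
    rw [if_neg hc.1.symm, if_neg hc.2.symm, mul_zero, mul_zero, add_zero,
      Finset.sum_eq_zero_iff_of_nonneg] at h2
    · exact hw (by simpa using h2 w (Finset.mem_univ w))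
    · exact fun v _ => mul_nonneg (h0 v) (by split_ifs <;> norm_num)
  have hlt : (∑ w : Equiv.Perm (Fin n), β w * (if w r = s then 1 else 0)) <
      ∑ w : Equiv.Perm (Fin n), β w * (if w p = q then 1 else 0) := by
    refine Finset.sum_lt_sum (fun w _ => ?_) ⟨z, Finset.mem_univ z, ?_⟩
    · rcases eq_or_ne (β w) 0 with hw | hw
      · simp [hw]
      · by_cases hr : w r = s
        · by_cases hp : w p = q
          · simp [hr, hp]
          · exact absurd ⟨w, (h1 w hw).1, hsupp w hw, hp, hr⟩ hcon
        · rw [if_neg hr, mul_zero]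
          exact mul_nonneg (h0 w) (by split_ifs <;> norm_num)
    · simpa [hzp, hzr] using hz
  rw [heval, heval, if_pos hxp, if_neg hyp, if_pos hxr, if_neg hyr] at hlt
  exact lt_irrefl _ hlt

theorem Exchange.inv (h : Exchange x y z) : Exchange x⁻¹ y⁻¹ z⁻¹ := by
  intro p q r s h1 h2 h3 h4 h5 h6
  rw [Ne, Perm.inv_eq_iff_eq] at *
  obtain ⟨w, hw, hwu, hwp, hwr⟩ := h q p s r h1.symm (Ne.symm h2) h3.symm h4.symm
    (Ne.symm h5) (Ne.symm h6)
  refine ⟨w⁻¹, hw.inv, fun i => ?_, fun e => hwp (Perm.inv_eq_iff_eq.1 e).symm,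
    Perm.inv_eq_iff_eq.2 hwr.symm⟩
  have h7 : w (w⁻¹ i) = i := w.apply_symm_apply i
  rcases hwu (w⁻¹ i) with h8 | h8
  · exact Or.inl (Perm.inv_eq_iff_eq.2 (h7.symm.trans h8)).symm
  · exact Or.inr (Perm.inv_eq_iff_eq.2 (h7.symm.trans h8)).symm

/-- The backward arc of an ascending step-back keeps its direction. -/
theorem AscSB.arc_follows (hx : IsPSBT x) (hy : IsPSBT y)
    (harcs : ∀ i, z i = x i ∨ z i = y i) {j : Fin n} (hsb : AscSB z (z j) j) (hzx : z j = x j) :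
    (z j = x j ∧ AscArc x j) ∨ (z j = y j ∧ AscArc y j) := by
  by_cases hxj : AscArc x j
  · exact Or.inl ⟨hzx, hxj⟩
  right
  obtain ⟨a, ha⟩ := z.surjective j
  have hai := hsb.pred_lt ha
  obtain ⟨h1, -, -, h4⟩ := hsb
  have hjtop := ne_topCity_of_lt h4
  have hya : y a = j := by
    refine (harcs a).elim (fun h => ?_) (fun h => h ▸ ha)
    rw [ha] at h
    exfalso
    have hxa : ¬ AscArc x a := fun hc => hxj (h ▸ hc.apply (h ▸ hjtop))
    rcases hx.gt_or_descSB hxa with h5 | ⟨h5, -⟩ <;> rw [← h] at h5 <;>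
      simp only [Fin.lt_def] at * <;> omega
  have hyA : AscArc y a := by
    by_contra hc
    rcases hy.gt_or_descSB hc with h5 | ⟨h5, -⟩ <;> rw [hya] at h5 <;>
      simp only [Fin.lt_def] at * <;> omega
  have hi0 : z j ≠ 0 := by
    intro h
    rw [h] at hai
    simp at hai
  have hyi : y (z j) = z (z j) := by
    refine (harcs (z j)).elim (fun h => ?_) (fun h => h.symm)
    exfalso
    have hxi : ¬ AscArc x (z j) := by
      rw [hzx] at hi0 ⊢
      exact fun hc => hxj (hc.of_apply hi0)
    rcases hx.gt_or_descSB hxi with h5 | ⟨h5, -⟩ <;> rw [← h] at h5 <;>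
      simp only [Fin.lt_def] at * <;> omega
  have hyI : AscArc y (z j) := by
    by_contra hc
    rcases hy.gt_or_descSB hc with h5 | ⟨h5, -⟩ <;> rw [hyi] at h5 <;>
      simp only [Fin.lt_def] at * <;> omega
  have hyj : AscArc y j := hya ▸ hyA.apply (hya ▸ hjtop)
  rcases hy.asc_gap hyA hyI hai (by rw [hya, Fin.lt_def]; omega) with h5 | h5
  · exact ⟨by rw [← h5, hya], hyj⟩
  · rw [hyi] at h5
    simp only [Fin.lt_def] at *
    omega

/-- An upward arc of the ascending path of `z` that `x` traverses in its descending path lies on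
the ascending path of `y`, provided the preceding arc of `z` keeps its direction. -/
theorem up_arc_follows (hx : IsPSBT x) (hy : IsPSBT y) (hz : IsPSBT z)
    (harcs : ∀ i, z i = x i ∨ z i = y i) (hex : Exchange x y z) {i c : Fin n}
    (hi : AscArc z i) (hup : i < z i) (hzx : z i = x i) (hxi : ¬ AscArc x i) (hc : z c = i)
    (hpre : (z c = x c ∧ AscArc x c) ∨ (z c = y c ∧ AscArc y c)) :
    z i = y i ∧ AscArc y i := by
  have hitop := ne_topCity_of_lt hup
  obtain ⟨b, hb⟩ := x.surjective i
  obtain ⟨hxi1, hib, hxxi⟩ : (x i).val = i.val + 1 ∧ x i < b ∧ x (x i) < i := by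
    rcases hx.gt_or_descSB hxi with h | h
    · exact absurd (hzx ▸ hup) (lt_asymm h)
    · exact ⟨h.1, h.lt_pred hb, h.2.2.2⟩
  have pos_ne_zero : ∀ {k l : Fin n}, k < l → l ≠ 0 := by
    rintro k l h rfl
    simp at h
  have hi0 := pos_ne_zero hxxi
  obtain ⟨hyc, hycA⟩ : y c = i ∧ AscArc y c := by
    rcases hpre with ⟨h1, h2⟩ | ⟨h1, h2⟩
    · exact absurd ((h1.symm.trans hc) ▸ h2.apply ((h1.symm.trans hc) ▸ hitop)) hxi
    · exact ⟨h1.symm.trans hc, h2⟩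
  have hyi : AscArc y i := hyc ▸ hycA.apply (hyc ▸ hitop)
  refine ⟨?_, hyi⟩
  by_contra hne
  have hzcA : AscArc z c := AscArc.of_apply (hc ▸ hi) (hc ▸ hi0)
  have hci : c < i := by
    rcases hz.lt_or_ascSB hzcA with h | ⟨h1, -, -, h4⟩
    · rwa [hc] at h
    · rw [hc, hzx] at h4
      rw [hc] at h1
      simp only [Fin.lt_def] at *
      omega
  have hbc : b ≠ c := by
    rintro rfl
    simp only [Fin.lt_def] at *
    omega
  obtain ⟨w, hw, hwarcs, hwi, hwb⟩ := hex i (x i) b i rfl (hzx ▸ Ne.symm hne) hzx hb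
    (fun h => hbc (y.injective (h.trans hyc.symm))) (fun h => hbc (z.injective (h.trans hc.symm)))
  have hwyi : w i = y i := (hwarcs i).resolve_left hwi
  have hwbA : ¬ AscArc w b := fun h => by
    rcases hw.lt_or_ascSB h with h1 | ⟨h1, -⟩ <;> rw [hwb] at h1 <;>
      simp only [Fin.lt_def] at * <;> omega
  have hwiA : ¬ AscArc w i := fun h => hwbA (AscArc.of_apply (hwb.symm ▸ h) (hwb.symm ▸ hi0))
  have hyii : y i < i := by
    rcases hw.gt_or_descSB hwiA with h1 | ⟨h1, -⟩
    · rwa [hwyi] at h1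
    · exact absurd (Fin.ext (h1.trans hxi1.symm)) hwi
  obtain ⟨u, hu⟩ : ∃ u, y i = u := ⟨_, rfl⟩
  obtain ⟨hiu, hcu, hiyu⟩ : i.val = u.val + 1 ∧ c < u ∧ i < y u := by
    rcases hy.lt_or_ascSB hyi with h | h
    · exact absurd h (lt_asymm hyii)
    · rw [hu] at h
      exact ⟨h.1, h.pred_lt hyc, h.2.2.2⟩
  have hwu : w i = u := hwyi.trans hu
  have hu0 := pos_ne_zero hcu
  have hui : u < i := hu ▸ hyii
  have hutop := ne_topCity_of_lt hui
  have hwuA : ¬ AscArc w u := fun h => hwiA (AscArc.of_apply (hwu.symm ▸ h) (hwu.symm ▸ hu0))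
  have hwuu : w u < u := by
    rcases hw.gt_or_descSB hwuA with h1 | ⟨h1, -⟩
    · exact h1
    · have h2 : w u = i := Fin.ext (h1.trans hiu.symm)
      have h3 : b = u := w.injective (hwb.trans h2.symm)
      simp only [Fin.lt_def, Fin.ext_iff] at *
      omega
  have hwxu : w u = x u := by
    refine (hwarcs u).resolve_right fun h => ?_
    rw [h] at hwuu
    exact lt_asymm hiyu (hwuu.trans hui)
  obtain ⟨e, hze⟩ := z.surjective u
  have hxe : x e = u := by
    rcases harcs e with h | h
    · exact h.symm.trans hze
    · have h2 : e = i := y.injective (h.symm.trans (hze.trans hu.symm))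
      rw [h2] at hze
      rw [hze] at hup
      exact absurd hup (lt_asymm hui)
  by_cases hzu : AscArc z u
  · have hzuc : z u = c := by
      rcases hz.asc_gap hzcA hzu hcu (hc.symm ▸ hui) with h | h
      · rw [hc] at h
        rw [h] at hup
        exact absurd hup (lt_asymm hui)
      · exact h
    have hxu : x u = c := by
      rcases harcs u with h | h
      · exact h.symm.trans hzuc
      · rw [← h, hzuc] at hiyu
        exact absurd hiyu (lt_asymm hci)
    obtain ⟨huc, hec⟩ : u.val = c.val + 1 ∧ e < c := by
      rcases hz.lt_or_ascSB hzu with h | h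
      · rw [hzuc] at h
        exact absurd h (lt_asymm hcu)
      · rw [hzuc] at h
        exact ⟨h.1, h.pred_lt hze⟩
    have hwuc : w u = c := hwxu.trans hxu
    have hwcA : ¬ AscArc w c := fun h =>
      hwuA (AscArc.of_apply (hwuc.symm ▸ h) (hwuc.symm ▸ pos_ne_zero hec))
    have hxcc : x c < c := by
      have hwc : w c = x c := (hwarcs c).resolve_right fun h =>
        hbc (w.injective (hwb.trans (h.trans hyc).symm))
      rcases hw.gt_or_descSB hwcA with h | h
      · rwa [hwc] at h
      · have h2 := h.lt_pred hwuc
        have h1 := h.1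
        rw [Fin.lt_def] at h2
        omega
    by_cases hxuA : AscArc x u
    · rcases hx.lt_or_ascSB hxuA with h | ⟨-, -, -, h⟩
      · rw [hxu] at h
        exact lt_asymm h hcu
      · rw [hxu] at h
        exact lt_asymm (h.trans hxcc) hcu
    · have hxeA : ¬ AscArc x e := fun h => hxuA (hxe ▸ h.apply (hxe ▸ hutop))
      have hecv : e.val < c.val := hec
      have hcuv : c.val < u.val := hcu
      rcases hx.gt_or_descSB hxeA with h | ⟨h, -⟩ <;> rw [hxe] at h
      · exact lt_asymm h (hec.trans hcu)
      · omega
  · have hzuu : z u < u := by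
      rcases hz.gt_or_descSB hzu with h | ⟨h, -⟩
      · exact h
      · have h2 : c = u := z.injective (hc.trans (Fin.ext (hiu.trans h.symm)))
        exact absurd hcu (h2 ▸ lt_irrefl _)
    have hzxu : z u = x u := (harcs u).resolve_right fun h =>
      lt_asymm (hzuu.trans hui) (h ▸ hiyu)
    have hzeA : ¬ AscArc z e := fun h => hzu (hze ▸ h.apply (hze ▸ hutop))
    have hzt : AscArc z (x i) := hzx ▸ hi.apply (hzx ▸ ne_topCity_of_lt hib)
    have hxuA : ¬ AscArc x u := fun hA => by
      rcases hx.lt_or_ascSB hA with h | h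
      · exact lt_asymm h (hzxu ▸ hzuu)
      · have h2 := h.pred_lt hxe
        rcases hz.gt_or_descSB hzeA with h3 | ⟨-, -, -, h3⟩ <;> rw [hze] at h3 <;>
          simp only [Fin.lt_def, Fin.ext_iff] at * <;> omega
    have hxtA : ¬ AscArc x (x i) := fun h => hxi (h.of_apply (pos_ne_zero (hzx ▸ hup)))
    have hxtu : x (x i) < u := by
      have : x (x i) ≠ u := fun h => hzeA (x.injective (h.trans hxe.symm) ▸ hzt)
      simp only [Fin.lt_def, Ne, Fin.ext_iff] at *
      omega
    have hxte : x (x i) = e := by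
      have hut : u < x i := by
        rw [Fin.lt_def]
        omega
      rcases hx.desc_gap hxtA hxuA hut hxtu with h | h
      · exact x.injective (h.trans hxe.symm)
      · rw [← hzxu] at h
        rw [h] at hzuu
        exact absurd hzuu (lt_asymm hut)
    obtain ⟨g, hzg⟩ := z.surjective e
    obtain ⟨hue, hug, hzue⟩ : u.val = e.val + 1 ∧ u < g ∧ z u < e := by
      rcases hz.gt_or_descSB hzeA with h | h
      · rw [hze] at h
        exact absurd h (lt_asymm (hxte ▸ hxtu))
      · rw [hze] at h
        exact ⟨h.1, h.lt_pred hzg, h.2.2.2⟩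
    have heu : e < u := hxte ▸ hxtu
    have hyg : y g = e := by
      rcases harcs g with h | h
      · have h2 : g = x i := x.injective (h.symm.trans (hzg.trans hxte.symm))
        rw [h2] at hzg
        rcases hz.lt_or_ascSB hzt with h3 | ⟨h3, -⟩ <;> rw [hzg] at h3 <;>
          simp only [Fin.lt_def] at * <;> omega
      · exact h.symm.trans hzg
    obtain ⟨v, hwv⟩ := w.surjective e
    have huv : u < v := by
      rcases hwarcs v with h | h
      · have h2 : v = x i := x.injective (h.symm.trans (hwv.trans hxte.symm))
        rw [h2, Fin.lt_def]
        omega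
      · have h2 : v = g := y.injective (h.symm.trans (hwv.trans hyg.symm))
        rwa [h2]
    by_cases hweA : AscArc w e
    · have hwvA : AscArc w v := AscArc.of_apply (hwv.symm ▸ hweA) (hwv.symm ▸ pos_ne_zero hzue)
      rcases hw.lt_or_ascSB hwvA with h | ⟨h, -⟩ <;> rw [hwv] at h <;>
        simp only [Fin.lt_def] at * <;> omega
    · rcases hw.desc_gap hwuA hweA heu (by rw [hwxu, ← hzxu]; exact hzue) with h | h
      · have h2 : w u = v := w.injective (h.trans hwv.symm)
        exact lt_asymm huv (h2 ▸ hwuu)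
      · have h2 : e = i := w.injective (h.trans hwu.symm)
        exact lt_asymm heu (h2 ▸ hui)

theorem asc_arcs_follow (hx : IsPSBT x) (hy : IsPSBT y) (hz : IsPSBT z)
    (harcs : ∀ i, z i = x i ∨ z i = y i) (hxy : Exchange x y z) (hyx : Exchange y x z)
    (i : Fin n) (hi : AscArc z i) :
    (z i = x i ∧ AscArc x i) ∨ (z i = y i ∧ AscArc y i) := by
  have harcs' : ∀ i, z i = y i ∨ z i = x i := fun i => (harcs i).symm
  have hback : ∀ j, AscSB z (z j) j → (z j = x j ∧ AscArc x j) ∨ (z j = y j ∧ AscArc y j) :=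
    fun j hj => (harcs j).elim (hj.arc_follows hx hy harcs)
      fun h => (hj.arc_follows hy hx harcs' h).symm
  induction i using WellFoundedLT.induction with
  | _ i ih =>
  rcases hz.lt_or_ascSB hi with hup | hsb
  swap
  · exact hback i hsb
  have hzero : ∀ {τ : Equiv.Perm (Fin n)}, AscArc τ 0 := by
    intro τ
    refine ascArc_iff.2 ⟨0, rfl, fun m hm => ?_⟩
    obtain rfl := Nat.le_zero.1 hm
    exact hx.1.zero_ne_topCity
  by_cases hi0 : i = 0
  · subst hi0
    exact (harcs 0).imp (fun h => ⟨h, hzero⟩) (fun h => ⟨h, hzero⟩)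
  obtain ⟨c, hc⟩ := z.surjective i
  have hcA : AscArc z c := AscArc.of_apply (hc.symm ▸ hi) (hc.symm ▸ hi0)
  have hpre : (z c = x c ∧ AscArc x c) ∨ (z c = y c ∧ AscArc y c) := by
    rcases hz.lt_or_ascSB hcA with h | h
    · exact ih c (hc ▸ h) hcA
    · exact hback c h
  rcases harcs i with h | h
  · by_cases hxi : AscArc x i
    · exact Or.inl ⟨h, hxi⟩
    · exact Or.inr (up_arc_follows hx hy hz harcs hxy hi hup h hxi hc hpre)
  · by_cases hyi : AscArc y i
    · exact Or.inr ⟨h, hyi⟩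
    · exact Or.inl (up_arc_follows hy hx hz harcs' hyx hi hup h hyi hc hpre.symm)

theorem desc_arcs_follow (hx : IsPSBT x) (hy : IsPSBT y) (hz : IsPSBT z)
    (harcs : ∀ i, z i = x i ∨ z i = y i) (hxy : Exchange x y z) (hyx : Exchange y x z)
    (i : Fin n) (hi : ¬ AscArc z i) :
    (z i = x i ∧ ¬ AscArc x i) ∨ (z i = y i ∧ ¬ AscArc y i) := by
  have harcs' : ∀ j, z⁻¹ j = x⁻¹ j ∨ z⁻¹ j = y⁻¹ j := fun j => by
    have hj : z (z⁻¹ j) = j := z.apply_symm_apply j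
    exact (harcs (z⁻¹ j)).imp (fun h => (Perm.inv_eq_iff_eq.2 (hj.symm.trans h)).symm)
      (fun h => (Perm.inv_eq_iff_eq.2 (hj.symm.trans h)).symm)
  have hzi : z⁻¹ (z i) = i := z.symm_apply_apply i
  have key := asc_arcs_follow hx.inv hy.inv hz.inv harcs' hxy.inv hyx.inv (z i)
    ((hz.1.ascArc_inv_apply_iff i).2 hi)
  rw [hzi] at key
  refine key.imp (fun ⟨h1, h2⟩ => ?_) (fun ⟨h1, h2⟩ => ?_)
  · have h3 : z i = x i := Perm.inv_eq_iff_eq.1 h1.symm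
    exact ⟨h3, (hx.1.ascArc_inv_apply_iff i).1 (h3 ▸ h2)⟩
  · have h3 : z i = y i := Perm.inv_eq_iff_eq.1 h1.symm
    exact ⟨h3, (hy.1.ascArc_inv_apply_iff i).1 (h3 ▸ h2)⟩

end Exchange

end PSBPaper

open PSBPaper Equiv in
/-- Part 1 of the proof of Theorem 2, conclusion.
With `x`, `y`, `z` as in the nonadjacency setting, every arc of the ascending
path of `z` is an arc of the ascending path of `x` or of the ascending path of
`y`, and every arc of the descending path of `z` is an arc of the descending
path of `x` or of the descending path of `y`. -/
theorem arcs_follow_directions (n : ℕ)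
    (x y z : Equiv.Perm (Fin (n + 4)))
    (hx : IsPSBT x) (hy : IsPSBT y) (hxy : x ≠ y)
    (hnadj : Nonadjacent x y)
    (hz : IsPSBT z) (hzx : z ≠ x) (hzy : z ≠ y)
    (harcs : ∀ i, z i = x i ∨ z i = y i)
    (hwit : PositiveWitness x y z) :
    (∀ i : Fin (n + 4), AscArc z i →
      ((z i = x i ∧ AscArc x i) ∨ (z i = y i ∧ AscArc y i))) ∧
    (∀ i : Fin (n + 4), ¬ AscArc z i →
      ((z i = x i ∧ ¬ AscArc x i) ∨ (z i = y i ∧ ¬ AscArc y i))) := by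
  exact ⟨asc_arcs_follow hx hy hz harcs hwit.exchange hwit.symm.exchange,
    desc_arcs_follow hx hy hz harcs hwit.exchange hwit.symm.exchange⟩
end
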